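/- For all positive integers n, m and every partition ν with ℓ(ν) ≤ n + m, the following identity holds in ℤ[x_1,…,x_n,y_1,…,y_m]: s_ν(x_1,…,x_n,y_1,…,y_m) = Σ_{λ,μ} c^ν_{λμ} s_λ(x_1,…,x_n) s_μ(y_1,…,y_m), where the sum runs over all pairs of partitions λ, μ with ℓ(λ) ≤ n, ℓ(μ) ≤ m and |λ| + |μ| = |ν|. -/

import Mathlib

open MvPolynomial
open scoped Classical

/-- A partition: a weakly decreasing sequence of non-negative integers
with finitely many nonzero parts (indexed from 0). -/
structure Partn where
  parts : ℕ → ℕ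
  antitone : ∀ i j, i ≤ j → parts j ≤ parts i
  eventually_zero : ∃ N, ∀ i, N ≤ i → parts i = 0

namespace Partn

/-- The weight `|λ|` of a partition: the sum of its parts. -/
noncomputable def weight (p : Partn) : ℕ := ∑ᶠ i, p.parts i

/-- `ℓ(λ) ≤ n`: all parts from index `n` on vanish. -/
def LengthLE (p : Partn) (n : ℕ) : Prop := ∀ i, n ≤ i → p.parts i = 0

/-- The parts of the conjugate partition `λ'`:
`λ'_i` is the number of indices `j` with `λ_j > i`. -/
noncomputable def conjParts (p : Partn) (i : ℕ) : ℕ := Nat.card {j : ℕ // i < p.parts j}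

end Partn

/-- The alternant `det(x_i^{l_j + n - j})_{1 ≤ i,j ≤ n}` (indices taken 0-based). -/
noncomputable def alternant (n : ℕ) (l : ℕ → ℕ) : MvPolynomial (Fin n) ℤ :=
  (Matrix.of fun i j : Fin n =>
    (X i : MvPolynomial (Fin n) ℤ) ^ (l (j : ℕ) + (n - 1 - (j : ℕ)))).det

/-- The Vandermonde determinant `det(x_i^{n-j})_{1 ≤ i,j ≤ n}` (0-based). -/
noncomputable def vandermondeP (n : ℕ) : MvPolynomial (Fin n) ℤ :=
  (Matrix.of fun i j : Fin n =>
    (X i : MvPolynomial (Fin n) ℤ) ^ (n - 1 - (j : ℕ))).det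

/-- The Schur polynomial `s_l(x_1,…,x_n)`: the (unique, since `ℤ[x]` is a domain
and the Vandermonde determinant is nonzero) quotient of the alternant by the
Vandermonde determinant, when the latter divides the former. -/
noncomputable def schur (n : ℕ) (l : ℕ → ℕ) : MvPolynomial (Fin n) ℤ :=
  if h : ∃ q : MvPolynomial (Fin n) ℤ, q * vandermondeP n = alternant n l then h.choose else 0

/-- The Littlewood–Richardson coefficient `c^ν_{λμ}`: the coefficient of `s_ν` in the
Schur-basis expansion of `s_λ · s_μ` in `|λ| + |μ|` variables, extracted as the
coefficient of the dominant monomial `x^{ν+ρ}` in `s_λ · s_μ · (Vandermonde)`.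
It is zero unless `|ν| = |λ| + |μ|`. -/
noncomputable def lrCoeff (l m ν : Partn) : ℤ :=
  if ν.weight = l.weight + m.weight then
    MvPolynomial.coeff
      (Finsupp.equivFunOnFinite.symm fun j : Fin (l.weight + m.weight) =>
        ν.parts (j : ℕ) + (l.weight + m.weight - 1 - (j : ℕ)))
      (schur (l.weight + m.weight) l.parts * schur (l.weight + m.weight) m.parts *
        vandermondeP (l.weight + m.weight))
  else 0

/-! ### The Cauchy determinant -/

lemma reflect_prod_X_sub_C {B ι : Type*} [CommRing B] (s : Finset ι) (z : ι → B) :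
    Polynomial.reflect s.card (∏ k ∈ s, (Polynomial.X - Polynomial.C (z k))) =
      ∏ k ∈ s, (1 - Polynomial.C (z k) * Polynomial.X) := by
  classical
  induction s using Finset.induction_on with
  | empty => simp
  | insert a s ha ih =>
    rw [Finset.prod_insert ha, Finset.prod_insert ha, Finset.card_insert_of_notMem ha, add_comm,
      Polynomial.reflect_mul, ih]
    · congr 1
      rw [Polynomial.reflect_sub, Polynomial.reflect_C]
      have : (Polynomial.X : Polynomial B) = Polynomial.X ^ 1 := by simp
      rw [this, Polynomial.reflect_monomial]
      simp
    · exact Polynomial.natDegree_X_sub_C_le _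
    · refine (Polynomial.natDegree_prod_le _ _).trans ?_
      refine (Finset.sum_le_card_nsmul _ _ 1 fun k _ => Polynomial.natDegree_X_sub_C_le _).trans ?_
      simp

/-- descending Vandermonde determinant -/
noncomputable def vd {B : Type*} [CommRing B] {M : ℕ} (x : Fin M → B) : B :=
  (Matrix.of fun i j : Fin M => x i ^ (M - 1 - (j : ℕ))).det

lemma vd_eq {B : Type*} [CommRing B] {M : ℕ} (x : Fin M → B) :
    vd x = ∏ i : Fin M, ∏ j ∈ Finset.Ioi i, (x i - x j) := by
  have := Matrix.det_projVandermonde (fun _ => (1 : B)) x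
  simp only [one_mul] at this
  rw [← this, vd]
  congr 1
  ext i j
  simp only [Matrix.of_apply, Matrix.projVandermonde_apply, one_pow, one_mul, Fin.val_rev]
  congr 1
  omega

lemma cauchy_det_poly {B : Type*} [CommRing B] [IsDomain B] {M : ℕ} (x z : Fin M → B)
    (hz : Function.Injective z) :
    (Matrix.of fun i j : Fin M => ∏ k ∈ Finset.univ.erase j, (1 - x i * z k)).det =
      vd x * vd z := by
  classical
  set Q : Fin M → Polynomial B := fun j =>
    ∏ k ∈ Finset.univ.erase j, (Polynomial.X - Polynomial.C (z k)) with hQ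
  have hcard : ∀ j : Fin M, (Finset.univ.erase j).card = M - 1 := by intro j; simp
  have hdeg : ∀ j, (Q j).natDegree ≤ M - 1 := by
    intro j
    refine (Polynomial.natDegree_prod_le _ _).trans ?_
    refine (Finset.sum_le_card_nsmul _ _ 1 fun k _ => Polynomial.natDegree_X_sub_C_le _).trans ?_
    simp
  set C' : Matrix (Fin M) (Fin M) B := Matrix.of fun r j => (Q j).coeff r with hC
  have hrefl : ∀ j, Polynomial.reflect (M - 1) (Q j) =
      ∏ k ∈ Finset.univ.erase j, (1 - Polynomial.C (z k) * Polynomial.X) := by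
    intro j
    rw [← hcard j]
    exact reflect_prod_X_sub_C _ _
  have h1 : (Matrix.of fun i j : Fin M => ∏ k ∈ Finset.univ.erase j, (1 - x i * z k)) =
      (Matrix.of fun i j : Fin M => x i ^ (M - 1 - (j : ℕ))) * C' := by
    ext i j
    have hM : 0 < M := by have := i.2; omega
    have e1 : ∏ k ∈ Finset.univ.erase j, (1 - x i * z k) =
        (Polynomial.reflect (M - 1) (Q j)).eval (x i) := by
      rw [hrefl, Polynomial.eval_prod]
      refine Finset.prod_congr rfl fun k _ => ?_
      simp only [Polynomial.eval_sub, Polynomial.eval_one, Polynomial.eval_mul, Polynomial.eval_C,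
        Polynomial.eval_X]
      ring
    have hd : (Polynomial.reflect (M - 1) (Q j)).natDegree < M := by
      have := Polynomial.natDegree_reflect_le (p := Q j) (N := M - 1)
      have := hdeg j
      omega
    rw [Matrix.of_apply, e1, Polynomial.eval_eq_sum_range' hd, Matrix.mul_apply,
      Finset.sum_range, ← Equiv.sum_comp Fin.revPerm]
    refine Finset.sum_congr rfl fun r _ => ?_
    simp only [Fin.revPerm_apply, Fin.val_rev, Polynomial.coeff_reflect, hC, Matrix.of_apply]
    have hr := r.2
    rw [Polynomial.revAt_le (by omega), mul_comm]
    congr 2 <;> omega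
  have h2 : Matrix.diagonal (fun j => ∏ k ∈ Finset.univ.erase j, (z j - z k)) =
      Matrix.vandermonde z * C' := by
    ext i j
    have hM : 0 < M := by have := i.2; omega
    have e1 : Matrix.diagonal (fun j => ∏ k ∈ Finset.univ.erase j, (z j - z k)) i j =
        (Q j).eval (z i) := by
      rw [hQ, Polynomial.eval_prod]
      by_cases hij : i = j
      · subst hij
        simp
      · rw [Matrix.diagonal_apply_ne _ hij, eq_comm]
        refine Finset.prod_eq_zero (i := i) (by simp [hij]) (by simp)
    rw [e1, Polynomial.eval_eq_sum_range' (n := M) (by have := hdeg j; omega), Matrix.mul_apply,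
      Finset.sum_range]
    refine Finset.sum_congr rfl fun r _ => ?_
    simp [hC, mul_comm]
  have h3 : ∏ j : Fin M, ∏ k ∈ Finset.univ.erase j, (z j - z k) =
      (Matrix.vandermonde z).det * vd z := by
    rw [vd_eq, Matrix.det_vandermonde]
    have : ∀ j : Fin M, ∏ k ∈ Finset.univ.erase j, (z j - z k) =
        (∏ k ∈ Finset.Iio j, (z j - z k)) * ∏ k ∈ Finset.Ioi j, (z j - z k) := by
      intro j
      rw [← Finset.prod_union]
      · refine Finset.prod_congr ?_ fun _ _ => rfl
        ext k
        simp
      · rw [Finset.disjoint_left]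
        intro a ha hb
        simp at ha hb
        exact absurd ha (not_lt.2 hb.le)
    simp_rw [this]
    rw [Finset.prod_mul_distrib]
    congr 1
    refine Finset.prod_comm' ?_
    intro a b
    simp
  have h4 : C'.det = vd z := by
    have hne : (Matrix.vandermonde z).det ≠ 0 := Matrix.det_vandermonde_ne_zero_iff.2 hz
    apply mul_left_cancel₀ hne
    rw [← h3, ← Matrix.det_mul, ← h2, Matrix.det_diagonal]
  rw [h1, Matrix.det_mul, h4]
  rfl

/-! ### The kernel as a power series in `z` -/

/-- geometric series `1/(1 - a z_j)` -/
noncomputable def geo {A : Type*} [CommRing A] {M : ℕ} (a : A) (j : Fin M) :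
    MvPowerSeries (Fin M) A :=
  fun d => if d = Finsupp.single j (d j) then a ^ (d j) else 0

lemma coeff_geo {A : Type*} [CommRing A] {M : ℕ} (a : A) (j : Fin M) (d : Fin M →₀ ℕ) :
    MvPowerSeries.coeff d (geo a j) = if d = Finsupp.single j (d j) then a ^ (d j) else 0 := rfl

lemma geo_mul {A : Type*} [CommRing A] {M : ℕ} (a : A) (j : Fin M) :
    (1 - MvPowerSeries.C a * MvPowerSeries.X j) * geo a j = 1 := by
  classical
  ext d
  rw [sub_mul, one_mul, map_sub, mul_assoc, MvPowerSeries.coeff_C_mul, MvPowerSeries.X,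
    MvPowerSeries.coeff_monomial_mul, MvPowerSeries.coeff_one, coeff_geo, coeff_geo]
  by_cases h0 : d = 0
  · subst h0
    simp
  by_cases hd : d = Finsupp.single j (d j)
  · have hj : d j ≠ 0 := by
      intro h
      rw [h] at hd
      simp at hd
      exact h0 hd
    have hle : Finsupp.single j 1 ≤ d := by
      rw [Finsupp.single_le_iff]
      omega
    have h2 : d - Finsupp.single j 1 = Finsupp.single j ((d - Finsupp.single j 1 : Fin M →₀ ℕ) j) := by
      ext i
      by_cases hij : j = i
      · subst hij; simp
      · rw [hd]; simp [hij]
    rw [if_pos hd, if_pos hle, if_pos h2, if_neg h0]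
    simp only [Finsupp.coe_tsub, Pi.sub_apply, Finsupp.single_eq_same]
    obtain ⟨k, hk⟩ := Nat.exists_eq_succ_of_ne_zero hj
    rw [hk]
    simp [pow_succ, mul_comm]
  · rw [if_neg hd, if_neg h0]
    split_ifs with h1 h2
    · exfalso
      apply hd
      ext i
      by_cases hij : j = i
      · subst hij; simp
      · have := DFunLike.congr_fun h2 i
        simpa [hij] using this
    · simp
    · simp

lemma coeff_prod_geo {A : Type*} [CommRing A] {M : ℕ} (y : Fin M → A) (α : Fin M →₀ ℕ) :
    MvPowerSeries.coeff α (∏ j, geo (y j) j) = ∏ j, y j ^ α j := by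
  classical
  rw [MvPowerSeries.coeff_prod]
  set l0 : Fin M →₀ (Fin M →₀ ℕ) := Finsupp.equivFunOnFinite.symm
    fun j => Finsupp.single j (α j) with hl0
  rw [Finset.sum_eq_single l0]
  · refine Finset.prod_congr rfl fun j _ => ?_
    rw [coeff_geo]
    simp [hl0]
  · intro l hl hne
    by_contra hcon
    apply hne
    have hall : ∀ j, l j = Finsupp.single j (l j j) := by
      intro j
      by_contra h
      apply hcon
      refine Finset.prod_eq_zero (Finset.mem_univ j) ?_
      rw [coeff_geo, if_neg h]
    rw [Finset.mem_finsuppAntidiag] at hl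
    ext1 j
    have : α j = l j j := by
      rw [← hl.1, Finsupp.finsetSum_apply, Finset.sum_eq_single j]
      · intro b _ hb
        rw [hall b]
        simp [hb]
      · simp
    rw [hall j, ← this]
    simp [hl0]
  · intro h
    exfalso
    apply h
    rw [Finset.mem_finsuppAntidiag]
    refine ⟨?_, by simp⟩
    ext j
    rw [Finsupp.finsetSum_apply, Finset.sum_eq_single j]
    · simp [hl0]
    · intro b _ hb
      simp [hl0, hb]
    · simp

/-- the Cauchy kernel -/
noncomputable def ker {A ι : Type*} [CommRing A] [Fintype ι] (M : ℕ) (x : ι → A) :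
    MvPowerSeries (Fin M) A := ∏ i, ∏ j, geo (x i) j

lemma X_inj_ps {A : Type*} [CommRing A] [Nontrivial A] {M : ℕ} :
    Function.Injective (fun j : Fin M => (MvPowerSeries.X j : MvPowerSeries (Fin M) A)) :=
  fun _ _ h => MvPowerSeries.X_inj.1 h

lemma det_geo {A : Type*} [CommRing A] [IsDomain A] {M : ℕ} (x : Fin M → A) :
    (Matrix.of fun i j : Fin M => (geo (x i) j)).det =
      MvPowerSeries.C (vd x) * (vd fun j : Fin M => (MvPowerSeries.X j : MvPowerSeries (Fin M) A)) *
        ker M x := by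
  classical
  have : IsDomain (MvPowerSeries (Fin M) A) := NoZeroDivisors.to_isDomain _
  have h := cauchy_det_poly (fun i => (MvPowerSeries.C (x i) : MvPowerSeries (Fin M) A))
    (fun j : Fin M => (MvPowerSeries.X j : MvPowerSeries (Fin M) A)) X_inj_ps
  have hC : vd (fun i => (MvPowerSeries.C (x i) : MvPowerSeries (Fin M) A)) =
      MvPowerSeries.C (vd x) := by
    rw [vd, vd, RingHom.map_det]
    congr 1
    ext1 i j
    simp
  rw [hC] at h
  rw [← h, ker, mul_comm, ← Matrix.det_mul_column]
  congr 1
  ext1 i j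
  simp only [Matrix.of_apply]
  rw [← Finset.mul_prod_erase _ _ (Finset.mem_univ j), mul_assoc, ← Finset.prod_mul_distrib,
    Finset.prod_congr rfl (g := fun _ => (1 : MvPowerSeries (Fin M) A)), Finset.prod_const_one,
    mul_one]
  intro k _
  rw [mul_comm]
  exact geo_mul _ _

lemma coeff_ker {A : Type*} [CommRing A] [IsDomain A] {M : ℕ} (x : Fin M → A) (α : Fin M →₀ ℕ) :
    MvPowerSeries.coeff α ((vd fun j : Fin M => (MvPowerSeries.X j : MvPowerSeries (Fin M) A)) *
        ker M x) * vd x = (Matrix.of fun i j : Fin M => x i ^ α j).det := by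
  rw [mul_comm, ← MvPowerSeries.coeff_C_mul, ← mul_assoc, ← det_geo, Matrix.det_apply,
    Matrix.det_apply, map_sum]
  refine Finset.sum_congr rfl fun σ _ => ?_
  simp only [Matrix.of_apply]
  rw [← coeff_prod_geo (fun j => x (σ j))]
  rcases Int.units_eq_one_or (Equiv.Perm.sign σ) with h | h <;> rw [h] <;> simp

/-! ### Schur polynomials: existence of the quotient -/

lemma vandermondeP_eq_vd (M : ℕ) : vandermondeP M = vd (fun i : Fin M => X i) := rfl

lemma vandermondeP_ne_zero (M : ℕ) : vandermondeP M ≠ 0 := by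
  rw [vandermondeP_eq_vd, vd_eq, Finset.prod_ne_zero_iff]
  intro i _
  rw [Finset.prod_ne_zero_iff]
  intro j hj
  rw [sub_ne_zero]
  intro h
  have := X_injective h
  simp [this] at hj

/-- the exponent `l + ρ` -/
noncomputable def expo (M : ℕ) (l : ℕ → ℕ) : Fin M →₀ ℕ :=
  Finsupp.equivFunOnFinite.symm fun j : Fin M => l (j : ℕ) + (M - 1 - (j : ℕ))

@[simp] lemma expo_apply (M : ℕ) (l : ℕ → ℕ) (j : Fin M) :
    expo M l j = l (j : ℕ) + (M - 1 - (j : ℕ)) := rfl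

/-- the alternant with arbitrary exponents -/
noncomputable def alt {M : ℕ} (α : Fin M →₀ ℕ) : MvPolynomial (Fin M) ℤ :=
  (Matrix.of fun i j : Fin M => (X i : MvPolynomial (Fin M) ℤ) ^ α j).det

lemma alternant_eq_alt (M : ℕ) (l : ℕ → ℕ) : alternant M l = alt (expo M l) := rfl

/-- Jacobi-Trudi polynomials, as coefficients of the kernel -/
noncomputable def jt {M : ℕ} (α : Fin M →₀ ℕ) : MvPolynomial (Fin M) ℤ :=
  MvPowerSeries.coeff α ((vd fun j : Fin M =>
    (MvPowerSeries.X j : MvPowerSeries (Fin M) (MvPolynomial (Fin M) ℤ))) *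
        ker M (fun i : Fin M => (X i : MvPolynomial (Fin M) ℤ)))

lemma jt_mul {M : ℕ} (α : Fin M →₀ ℕ) : jt α * vandermondeP M = alt α :=
  coeff_ker _ α

lemma schur_mul (M : ℕ) (l : ℕ → ℕ) : schur M l * vandermondeP M = alternant M l := by
  have h : ∃ q : MvPolynomial (Fin M) ℤ, q * vandermondeP M = alternant M l :=
    ⟨jt (expo M l), jt_mul _⟩
  rw [schur, dif_pos h]
  exact h.choose_spec

lemma jt_expo (M : ℕ) (l : ℕ → ℕ) : jt (expo M l) = schur M l := by
  apply mul_right_cancel₀ (vandermondeP_ne_zero M)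
  rw [jt_mul, schur_mul, alternant_eq_alt]

/-! ### Stability -/

/-- set the last variable to zero -/
noncomputable def kill (M : ℕ) : MvPolynomial (Fin (M + 1)) ℤ →ₐ[ℤ] MvPolynomial (Fin M) ℤ :=
  aeval (Fin.snoc (fun i : Fin M => (X i : MvPolynomial (Fin M) ℤ)) 0 :
    Fin (M + 1) → MvPolynomial (Fin M) ℤ)

lemma kill_alternant (M : ℕ) (l : ℕ → ℕ) :
    kill M (alternant (M + 1) l) = 0 ^ (l M) * ((∏ i, X i) * alternant M l) := by
  rw [alternant, AlgHom.map_det, Matrix.det_succ_row _ (Fin.last M), Finset.sum_eq_single (Fin.last M)]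
  · simp only [AlgHom.mapMatrix_apply, Matrix.map_apply, Matrix.of_apply, map_pow]
    have : kill M (X (Fin.last M)) = 0 := by simp [kill]
    rw [this, alternant, ← Matrix.det_mul_column]
    simp only [Fin.val_last, Nat.add_sub_cancel, Nat.sub_self, add_zero]
    rw [Even.neg_one_pow ⟨M, rfl⟩, one_mul]
    congr 2
    ext1 i j
    have hi : kill M (X (Fin.castSucc i)) = X i := by simp [kill]
    simp only [Matrix.submatrix_apply, Matrix.map_apply, Matrix.of_apply, map_pow,
      Fin.succAbove_last, hi, Fin.val_castSucc]
    rw [← pow_succ']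
    congr 1
    have := j.2
    omega
  · intro j _ hj
    simp only [AlgHom.mapMatrix_apply, Matrix.map_apply, Matrix.of_apply, map_pow]
    have : kill M (X (Fin.last M)) = 0 := by simp [kill]
    have hj' : (j : ℕ) < M := by
      rcases lt_or_eq_of_le (Nat.lt_succ_iff.1 j.2) with h | h
      · exact h
      · exact absurd (Fin.ext h) hj
    rw [this, zero_pow (by omega)]
    simp
  · simp

lemma vandermondeP_eq_alternant (M : ℕ) : vandermondeP M = alternant M (fun _ => 0) := by
  simp [vandermondeP, alternant]

lemma kill_vandermondeP (M : ℕ) :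
    kill M (vandermondeP (M + 1)) = (∏ i, X i) * vandermondeP M := by
  rw [vandermondeP_eq_alternant, kill_alternant, vandermondeP_eq_alternant]
  simp

lemma kill_schur (M : ℕ) (l : ℕ → ℕ) :
    kill M (schur (M + 1) l) = if l M = 0 then schur M l else 0 := by
  have h := congrArg (kill M) (schur_mul (M + 1) l)
  rw [map_mul, kill_alternant, kill_vandermondeP, ← schur_mul] at h
  have hne : (∏ i, X i : MvPolynomial (Fin M) ℤ) * vandermondeP M ≠ 0 := by
    refine mul_ne_zero ?_ (vandermondeP_ne_zero M)
    rw [Finset.prod_ne_zero_iff]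
    intro i _
    exact X_ne_zero i
  apply mul_right_cancel₀ hne
  rw [h]
  split_ifs with h0
  · rw [h0]; ring
  · rw [zero_pow h0]; ring

/-- extension of a tuple by zeros -/
def pad {A : Type*} [Zero A] {n : ℕ} (M : ℕ) (v : Fin n → A) (i : Fin M) : A :=
  if h : (i : ℕ) < n then v ⟨i, h⟩ else 0

lemma aeval_pad_succ {A : Type*} [CommRing A] {n M : ℕ} (h : n ≤ M) (v : Fin n → A)
    (f : MvPolynomial (Fin (M + 1)) ℤ) :
    aeval (pad (M + 1) v) f = aeval (pad M v) (kill M f) := by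
  rw [kill, ← AlgHom.comp_apply, comp_aeval]
  congr 2
  ext1 i
  refine Fin.lastCases ?_ (fun i => ?_) i
  · simp [pad, h]
  · simp [pad]

lemma aeval_pad_schur {A : Type*} [CommRing A] {n : ℕ} (v : Fin n → A) (l : Partn) {M : ℕ}
    (hM : n ≤ M) (hl : l.LengthLE n) :
    aeval (pad M v) (schur M l.parts) = aeval v (schur n l.parts) := by
  induction M, hM using Nat.le_induction with
  | base =>
    congr 2
    ext1 i
    simp [pad]
  | succ M hM ih => rw [aeval_pad_succ hM, kill_schur, if_pos (hl M hM), ih]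

lemma aeval_pad_schur_zero {A : Type*} [CommRing A] {n : ℕ} (v : Fin n → A) (l : Partn) {M : ℕ}
    (hM : n ≤ M) (hl' : l.LengthLE M) (hl : ¬ l.LengthLE n) :
    aeval (pad M v) (schur M l.parts) = 0 := by
  induction M, hM using Nat.le_induction with
  | base => exact absurd hl' hl
  | succ M hM ih =>
    rw [aeval_pad_succ hM, kill_schur]
    split_ifs with h
    · apply ih
      intro i hi
      have := l.antitone _ _ hi
      omega
    · simp

lemma coeff_kill (M : ℕ) (f : MvPolynomial (Fin (M + 1)) ℤ) (β : Fin (M + 1) →₀ ℕ)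
    (hβ : β (Fin.last M) = 0) :
    coeff (Finsupp.equivFunOnFinite.symm fun i : Fin M => β i.castSucc) (kill M f) = coeff β f := by
  induction f using MvPolynomial.induction_on' with
  | monomial d a =>
    have hk : kill M (monomial d a) = if d (Fin.last M) = 0 then
        monomial (Finsupp.equivFunOnFinite.symm fun i : Fin M => d i.castSucc) a else 0 := by
      rw [kill, aeval_monomial, Finsupp.prod_fintype _ _ (by simp), Fin.prod_univ_castSucc]
      simp only [Fin.snoc_castSucc, Fin.snoc_last]
      split_ifs with h
      · rw [h, monomial_eq, Finsupp.prod_fintype _ _ (by simp)]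
        simp
      · rw [zero_pow h]; simp
    rw [hk, coeff_monomial]
    split_ifs with h1 h2 h2
    · subst h2; simp
    · rw [coeff_monomial, if_neg]
      intro h
      apply h2
      ext i
      refine Fin.lastCases ?_ (fun i => ?_) i
      · rw [h1, hβ]
      · simpa using DFunLike.congr_fun h i
    · subst h2; exact absurd hβ h1
    · simp
  | add p q hp hq => simp [hp, hq]

/-- the coefficient defining the Littlewood-Richardson coefficient, in `M` variables -/
noncomputable def lrM (M : ℕ) (l m ν : Partn) : ℤ :=
  coeff (expo M ν.parts) (schur M l.parts * schur M m.parts * vandermondeP M)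

lemma lrM_succ (M : ℕ) (l m ν : Partn) (hl : l.LengthLE M) (hm : m.LengthLE M)
    (hν : ν.LengthLE M) : lrM (M + 1) l m ν = lrM M l m ν := by
  rw [lrM, lrM, ← coeff_kill _ _ _ (by simp [hν M le_rfl]), map_mul, map_mul, kill_schur,
    kill_schur, if_pos (hl M le_rfl), if_pos (hm M le_rfl), kill_vandermondeP]
  have h1 : (∏ i, X i : MvPolynomial (Fin M) ℤ) =
      monomial (Finsupp.equivFunOnFinite.symm fun _ => 1) 1 := by
    rw [monomial_eq, Finsupp.prod_fintype _ _ (by simp)]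
    simp
  have h2 : (Finsupp.equivFunOnFinite.symm fun i : Fin M => (expo (M + 1) ν.parts) i.castSucc) =
      (Finsupp.equivFunOnFinite.symm fun _ => 1) + expo M ν.parts := by
    ext i
    have := i.2
    simp
    omega
  rw [h1, h2, mul_left_comm, coeff_monomial_mul, one_mul]

lemma lrM_eq {N M : ℕ} (h : N ≤ M) (l m ν : Partn) (hl : l.LengthLE N) (hm : m.LengthLE N)
    (hν : ν.LengthLE N) : lrM M l m ν = lrM N l m ν := by
  induction M, h using Nat.le_induction with
  | base => rfl
  | succ M hM ih =>
    rw [lrM_succ _ _ _ _ (fun i hi => hl i (hM.trans hi)) (fun i hi => hm i (hM.trans hi))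
      (fun i hi => hν i (hM.trans hi)), ih]

/-! ### Weights and homogeneity -/

lemma Partn.weight_eq_range (p : Partn) {n : ℕ} (h : p.LengthLE n) :
    p.weight = ∑ i ∈ Finset.range n, p.parts i := by
  rw [Partn.weight]
  apply finsum_eq_sum_of_support_subset
  intro i hi
  simp only [Function.mem_support] at hi
  simp only [Finset.coe_range, Set.mem_Iio]
  by_contra h'
  exact hi (h i (by omega))

lemma Partn.weight_eq (p : Partn) {n : ℕ} (h : p.LengthLE n) :
    p.weight = ∑ i : Fin n, p.parts i := by
  rw [p.weight_eq_range h, Finset.sum_range]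

lemma Partn.lengthLE_weight (p : Partn) : p.LengthLE p.weight := by
  intro i hi
  by_contra hne
  obtain ⟨N, hN⟩ := p.eventually_zero
  have hiN : i < N := by
    by_contra h
    exact hne (hN i (by omega))
  rw [p.weight_eq_range (n := N) hN] at hi
  have h1 : ∑ j ∈ Finset.range (i + 1), 1 ≤ ∑ j ∈ Finset.range (i + 1), p.parts j := by
    refine Finset.sum_le_sum fun j hj => ?_
    rw [Finset.mem_range] at hj
    have := p.antitone j i (by omega)
    omega
  have h2 : ∑ j ∈ Finset.range (i + 1), p.parts j ≤ ∑ j ∈ Finset.range N, p.parts j :=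
    Finset.sum_le_sum_of_subset (Finset.range_mono (by omega))
  simp at h1
  omega

lemma Partn.parts_zero_le (p : Partn) : p.parts 0 ≤ p.weight := by
  obtain ⟨N, hN⟩ := p.eventually_zero
  rw [p.weight_eq_range (n := N + 1) (fun i hi => hN i (by omega))]
  exact Finset.single_le_sum (f := p.parts) (fun _ _ => Nat.zero_le _) (by simp)

lemma isHomogeneous_alt {M : ℕ} (α : Fin M →₀ ℕ) : (alt α).IsHomogeneous (∑ j, α j) := by
  rw [alt, Matrix.det_apply]
  refine IsHomogeneous.sum _ _ _ fun σ _ => ?_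
  have : (∏ j, (X (σ j) : MvPolynomial (Fin M) ℤ) ^ α j).IsHomogeneous (∑ j, α j) :=
    IsHomogeneous.prod _ _ _ fun j _ => isHomogeneous_X_pow _ _
  simp only [Matrix.of_apply]
  rcases Int.units_eq_one_or (Equiv.Perm.sign σ) with h | h <;> rw [h]
  · simpa using this
  · simpa using this.neg

lemma IsHomogeneous_of_mul {M : ℕ} {q V : MvPolynomial (Fin M) ℤ} {d v : ℕ}
    (hV : V.IsHomogeneous v) (hV0 : V ≠ 0) (hq : (q * V).IsHomogeneous (d + v)) :
    q.IsHomogeneous d := by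
  have key : ∀ k, homogeneousComponent (k + v) (q * V) = homogeneousComponent k q * V := by
    intro k
    conv_lhs => rw [← sum_homogeneousComponent q, Finset.sum_mul, map_sum]
    have : ∀ i, homogeneousComponent (k + v) (homogeneousComponent i q * V) =
        if i = k then homogeneousComponent k q * V else 0 := by
      intro i
      rw [homogeneousComponent_of_mem
        ((homogeneousComponent_isHomogeneous i q).mul hV : _ ∈ homogeneousSubmodule _ _ _)]
      by_cases h : i = k
      · subst h; simp
      · rw [if_neg h, if_neg (by omega)]
    simp_rw [this]
    rw [Finset.sum_ite_eq']
    split_ifs with h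
    · rfl
    · rw [homogeneousComponent_eq_zero k q (by simpa using h), zero_mul]
  have h0 : ∀ k, k ≠ d → homogeneousComponent k q = 0 := by
    intro k hk
    have := key k
    rw [homogeneousComponent_of_mem (hq : _ ∈ homogeneousSubmodule _ _ _), if_neg (by omega)] at this
    rcases mul_eq_zero.1 this.symm with h | h
    · exact h
    · exact absurd h hV0
  have hd : q = homogeneousComponent d q := by
    conv_lhs => rw [← sum_homogeneousComponent q]
    rw [Finset.sum_eq_single d]
    · intro b _ hb
      exact h0 b hb
    · intro h
      exact homogeneousComponent_eq_zero d q (by simpa using h)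
  rw [hd]
  exact homogeneousComponent_isHomogeneous d q

lemma isHomogeneous_vandermondeP (M : ℕ) :
    (vandermondeP M).IsHomogeneous (∑ j : Fin M, (M - 1 - (j : ℕ))) := by
  have := isHomogeneous_alt (expo M fun _ => 0)
  rw [← alternant_eq_alt, ← vandermondeP_eq_alternant] at this
  simpa using this

lemma isHomogeneous_schur (M : ℕ) (l : Partn) (hl : l.LengthLE M) :
    (schur M l.parts).IsHomogeneous l.weight := by
  refine IsHomogeneous_of_mul (isHomogeneous_vandermondeP M) (vandermondeP_ne_zero M) ?_
  rw [schur_mul, alternant_eq_alt, l.weight_eq hl, ← Finset.sum_add_distrib]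
  exact isHomogeneous_alt _

lemma lrM_zero (M : ℕ) (l m ν : Partn) (hl : l.LengthLE M) (hm : m.LengthLE M)
    (hν : ν.LengthLE M) (h : l.weight + m.weight ≠ ν.weight) : lrM M l m ν = 0 := by
  have hh := ((isHomogeneous_schur M l hl).mul (isHomogeneous_schur M m hm)).mul
    (isHomogeneous_vandermondeP M)
  rw [lrM]
  apply hh.coeff_eq_zero
  have : (expo M ν.parts).degree = ν.weight + ∑ j : Fin M, (M - 1 - (j : ℕ)) := by
    rw [Finsupp.degree_eq_sum, ν.weight_eq hν, ← Finset.sum_add_distrib]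
    simp
  rw [this]
  omega

lemma lrCoeff_eq (l m ν : Partn) {M : ℕ} (h : l.weight + m.weight = ν.weight)
    (hM : ν.weight ≤ M) : lrCoeff l m ν = lrM M l m ν := by
  rw [lrCoeff, if_pos h.symm]
  rw [lrM_eq (N := l.weight + m.weight) (by omega)]
  · rfl
  · intro i hi; exact l.lengthLE_weight i (by omega)
  · intro i hi; exact m.lengthLE_weight i (by omega)
  · intro i hi; exact ν.lengthLE_weight i (by omega)

/-! ### Expansion of alternants -/

lemma alt_eq_sum {M : ℕ} (β : Fin M →₀ ℕ) :
    alt β = ∑ σ : Equiv.Perm (Fin M), (Equiv.Perm.sign σ : ℤ) •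
      monomial (Finsupp.equivFunOnFinite.symm fun i => β (σ i)) (1 : ℤ) := by
  rw [alt, ← Matrix.det_transpose, Matrix.det_apply]
  refine Finset.sum_congr rfl fun σ _ => ?_
  rw [monomial_eq, Finsupp.prod_fintype _ _ (by simp)]
  simp [Matrix.transpose_apply, Units.smul_def]

lemma coeff_alt {M : ℕ} (α β : Fin M →₀ ℕ) :
    coeff α (alt β) = ∑ σ : Equiv.Perm (Fin M), (Equiv.Perm.sign σ : ℤ) *
      if (Finsupp.equivFunOnFinite.symm fun i => β (σ i)) = α then 1 else 0 := by
  rw [alt_eq_sum, coeff_sum]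
  refine Finset.sum_congr rfl fun σ _ => ?_
  rw [coeff_smul, coeff_monomial, smul_eq_mul]

lemma exists_of_coeff_alt_ne {M : ℕ} (α β : Fin M →₀ ℕ) (h : coeff α (alt β) ≠ 0) :
    ∃ σ : Equiv.Perm (Fin M), ∀ i, β (σ i) = α i := by
  by_contra hcon
  push Not at hcon
  apply h
  rw [coeff_alt]
  refine Finset.sum_eq_zero fun σ _ => ?_
  rw [if_neg, mul_zero]
  intro h
  obtain ⟨i, hi⟩ := hcon σ
  exact hi (DFunLike.congr_fun h i)

lemma coeff_alt_self {M : ℕ} (α : Fin M →₀ ℕ) (h : Function.Injective α) :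
    coeff α (alt α) = 1 := by
  rw [coeff_alt, Finset.sum_eq_single 1]
  · rw [if_pos (by ext i; simp)]
    simp
  · intro σ _ hσ
    rw [if_neg, mul_zero]
    intro h'
    apply hσ
    ext i
    have := h (DFunLike.congr_fun h' i)
    simp [this]
  · simp

lemma alt_perm {M : ℕ} (α β : Fin M →₀ ℕ) (σ : Equiv.Perm (Fin M)) (h : ∀ i, β i = α (σ i)) :
    alt β = (Equiv.Perm.sign σ : ℤ) • alt α := by
  rw [alt, alt, zsmul_eq_mul]
  rw [← Matrix.det_permute']
  congr 1
  ext1 i j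
  simp [h]

lemma expo_strictAnti (M : ℕ) (l : Partn) : StrictAnti (expo M l.parts) := by
  intro i j hij
  have := l.antitone i j hij.le
  have h2 := j.2
  have : (i : ℕ) < j := hij
  simp only [expo_apply]
  omega

lemma strictAnti_gap {M : ℕ} (β : Fin M → ℕ) (h : StrictAnti β) (k : ℕ) (i j : Fin M)
    (hij : (j : ℕ) = i + k) : β j + k ≤ β i := by
  induction k generalizing j with
  | zero =>
    have : j = i := Fin.ext (by omega)
    simp [this]
  | succ k ih =>
    have hj := j.2
    have h1 := ih ⟨i + k, by omega⟩ rfl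
    have h2 : β j < β ⟨i + k, by omega⟩ := h (by rw [Fin.lt_def]; simp; omega)
    omega

lemma exists_partn {M D : ℕ} (β : Fin M →₀ ℕ) (h : StrictAnti β) (hD : ∀ j, β j + 1 ≤ D + M) :
    ∃ l : Partn, l.LengthLE M ∧ l.parts 0 ≤ D ∧ expo M l.parts = β := by
  refine ⟨⟨fun j => if hj : j < M then β ⟨j, hj⟩ - (M - 1 - j) else 0, ?_, M, ?_⟩, ?_, ?_, ?_⟩
  · intro i j hij
    by_cases hj : j < M
    · have hi : i < M := by omega
      simp only [hi, hj, dif_pos]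
      have := strictAnti_gap β h (j - i) ⟨i, hi⟩ ⟨j, hj⟩ (by simp; omega)
      omega
    · simp [hj]
  · intro i hi
    simp [not_lt.2 hi]
  · intro i hi
    simp [not_lt.2 hi]
  · show (if hj : 0 < M then β ⟨0, hj⟩ - (M - 1 - 0) else 0) ≤ D
    split_ifs with h0
    · have := hD ⟨0, h0⟩
      omega
    · omega
  · ext j
    have hj := j.2
    simp only [expo_apply, hj, dif_pos, Fin.eta]
    have := strictAnti_gap β h (M - 1 - j) j ⟨M - 1, by omega⟩ (by simp; omega)
    omega

lemma Partn.ext_parts {l l' : Partn} (h : l.parts = l'.parts) : l = l' := by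
  cases l; cases l'; simp at h; subst h; rfl

lemma Partn.eq_of_expo {M : ℕ} {l l' : Partn} (hl : l.LengthLE M) (hl' : l'.LengthLE M)
    (h : expo M l.parts = expo M l'.parts) : l = l' := by
  apply Partn.ext_parts
  ext j
  by_cases hj : j < M
  · have := DFunLike.congr_fun h ⟨j, hj⟩
    simp at this
    exact this
  · rw [hl j (by omega), hl' j (by omega)]

/-- partitions in an `M × D` box -/
def boxSet (M D : ℕ) : Set Partn := {l | l.LengthLE M ∧ l.parts 0 ≤ D}

lemma boxSet_finite (M D : ℕ) : (boxSet M D).Finite := by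
  have : Set.InjOn (fun (l : Partn) (i : Fin M) => l.parts i) (boxSet M D) := by
    intro l hl l' hl' h
    apply Partn.eq_of_expo hl.1 hl'.1
    ext i
    have := congrFun h i
    simp at this
    simp [this]
  refine Set.Finite.of_finite_image ?_ this
  refine (Set.finite_Iic (fun _ : Fin M => D)).subset ?_
  rintro _ ⟨l, hl, rfl⟩ i
  exact (l.antitone 0 i (Nat.zero_le _)).trans hl.2

/-- partitions in an `M × D` box -/
noncomputable def box (M D : ℕ) : Finset Partn := (boxSet_finite M D).toFinset

lemma mem_box {M D : ℕ} {l : Partn} : l ∈ box M D ↔ l.LengthLE M ∧ l.parts 0 ≤ D := by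
  simp [box, boxSet]

lemma alt_expand {M D : ℕ} (α : Fin M →₀ ℕ) (hα : ∀ j, α j + 1 ≤ D + M) :
    alt α = ∑ l ∈ box M D, coeff α (alternant M l.parts) • alternant M l.parts := by
  simp_rw [alternant_eq_alt]
  by_cases hinj : Function.Injective α
  · set σ : Equiv.Perm (Fin M) := Fin.revPerm.trans (Tuple.sort α) with hσ
    set β : Fin M →₀ ℕ := Finsupp.equivFunOnFinite.symm fun i => α (σ i) with hβ
    have hβσ : ∀ i, β i = α (σ i) := fun i => rfl
    have hanti : StrictAnti β := by
      have hm := Tuple.monotone_sort α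
      have ha : Antitone β := by
        intro i j hij
        exact hm (Fin.rev_le_rev.2 hij)
      refine ha.strictAnti_of_injective ?_
      intro i j hij
      exact σ.injective (hinj hij)
    obtain ⟨l, hl1, hl2, hl3⟩ := exists_partn β hanti (D := D) (fun j => hα _)
    rw [Finset.sum_eq_single l]
    · rw [hl3, alt_perm α β σ hβσ, coeff_smul, coeff_alt_self α hinj, smul_smul]
      rcases Int.units_eq_one_or (Equiv.Perm.sign σ) with h | h <;> rw [h] <;> simp
    · intro l' hl' hne
      by_contra hcon
      apply hne
      have hc : coeff α (alt (expo M l'.parts)) ≠ 0 := by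
        intro h
        rw [h, zero_smul] at hcon
        exact hcon rfl
      obtain ⟨τ, hτ⟩ := exists_of_coeff_alt_ne _ _ hc
      rw [mem_box] at hl'
      apply Partn.eq_of_expo hl'.1 hl1
      rw [hl3]
      have h1 := expo_strictAnti M l'
      have e1 : StrictMono (fun i => expo M l'.parts (Fin.rev i)) :=
        fun i j hij => h1 (Fin.rev_lt_rev.2 hij)
      have e2 : StrictMono (fun i => β (Fin.rev i)) :=
        fun i j hij => hanti (Fin.rev_lt_rev.2 hij)
      have : (fun i => expo M l'.parts (Fin.rev i)) = (fun i => β (Fin.rev i)) := by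
        refine (StrictMono.range_inj e1 e2).1 ?_
        ext a
        constructor
        · rintro ⟨i, rfl⟩
          refine ⟨Fin.rev (σ.symm (τ.symm (Fin.rev i))), ?_⟩
          simp only [Fin.rev_rev]
          rw [hβσ, Equiv.apply_symm_apply, ← hτ, Equiv.apply_symm_apply]
        · rintro ⟨i, rfl⟩
          refine ⟨Fin.rev (τ (σ (Fin.rev i))), ?_⟩
          simp only [Fin.rev_rev]
          rw [hβσ, ← hτ]
      ext i
      have := congrFun this (Fin.rev i)
      simpa only [Fin.rev_rev] using this
    · intro h
      exact absurd (mem_box.2 ⟨hl1, hl2⟩) h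
  · rw [Finset.sum_eq_zero]
    · rw [Function.Injective] at hinj
      push Not at hinj
      obtain ⟨i, j, hij, hne⟩ := hinj
      exact Matrix.det_zero_of_column_eq hne (fun k => by simp [hij])
    · intro l _
      by_contra hcon
      have hc : coeff α (alt (expo M l.parts)) ≠ 0 := by
        intro h
        rw [h, zero_smul] at hcon
        exact hcon rfl
      obtain ⟨τ, hτ⟩ := exists_of_coeff_alt_ne _ _ hc
      apply hinj
      intro i j hij
      rw [← hτ, ← hτ] at hij
      exact τ.injective ((expo_strictAnti M l).injective hij)

lemma jt_expand {M D : ℕ} (α : Fin M →₀ ℕ) (hα : ∀ j, α j + 1 ≤ D + M) :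
    jt α = ∑ l ∈ box M D, coeff α (alternant M l.parts) • schur M l.parts := by
  apply mul_right_cancel₀ (vandermondeP_ne_zero M)
  rw [jt_mul, alt_expand α hα, Finset.sum_mul]
  refine Finset.sum_congr rfl fun l _ => ?_
  rw [smul_mul_assoc, schur_mul]

/-! ### The main identity -/

/-- integer polynomials as power series -/
noncomputable def toPS (A : Type*) [CommRing A] (M : ℕ) :
    MvPolynomial (Fin M) ℤ →+* MvPowerSeries (Fin M) A :=
  coeToMvPowerSeries.ringHom.comp (MvPolynomial.map (Int.castRingHom A))

lemma coeff_toPS {A : Type*} [CommRing A] {M : ℕ} (f : MvPolynomial (Fin M) ℤ)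
    (α : Fin M →₀ ℕ) : MvPowerSeries.coeff α (toPS A M f) = ((coeff α f : ℤ) : A) := by
  simp [toPS, coeff_map]

lemma toPS_vandermondeP {A : Type*} [CommRing A] {M : ℕ} : toPS A M (vandermondeP M) =
    vd fun j : Fin M => (MvPowerSeries.X j : MvPowerSeries (Fin M) A) := by
  rw [vandermondeP, vd, RingHom.map_det]
  congr 1
  ext1 i j
  simp [toPS]

lemma map_ker {A : Type*} [CommRing A] {M : ℕ} (x : Fin M → A) :
    MvPowerSeries.map (aeval x : MvPolynomial (Fin M) ℤ →ₐ[ℤ] A).toRingHom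
      (toPS _ M (vandermondeP M) * ker M (fun i : Fin M => (X i : MvPolynomial (Fin M) ℤ))) =
      toPS _ M (vandermondeP M) * ker M x := by
  rw [map_mul]
  congr 1
  · ext α
    rw [MvPowerSeries.coeff_map, coeff_toPS, coeff_toPS, map_intCast]
  · rw [ker, ker, map_prod]
    refine Finset.prod_congr rfl fun i _ => ?_
    rw [map_prod]
    refine Finset.prod_congr rfl fun j _ => ?_
    ext α
    rw [MvPowerSeries.coeff_map, coeff_geo, coeff_geo]
    split_ifs <;> simp

lemma coeff_vker {A : Type*} [CommRing A] {M : ℕ} (x : Fin M → A) (α : Fin M →₀ ℕ) :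
    MvPowerSeries.coeff α (toPS _ M (vandermondeP M) * ker M x) = aeval x (jt α) := by
  rw [← map_ker, MvPowerSeries.coeff_map, toPS_vandermondeP]
  rfl

lemma coeff_mul_vker {A : Type*} [CommRing A] {M D : ℕ} (x : Fin M → A) (γ : Fin M →₀ ℕ)
    (hγ : ∀ j, γ j + 1 ≤ D + M) (H : MvPowerSeries (Fin M) A) :
    MvPowerSeries.coeff γ (H * (toPS _ M (vandermondeP M) * ker M x)) =
      ∑ l ∈ box M D, aeval x (schur M l.parts) *
        MvPowerSeries.coeff γ (H * toPS _ M (alternant M l.parts)) := by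
  classical
  have h1 : ∀ l : Partn, aeval x (schur M l.parts) *
        MvPowerSeries.coeff γ (H * toPS _ M (alternant M l.parts)) =
      MvPowerSeries.coeff γ (H * (MvPowerSeries.C (aeval x (schur M l.parts)) *
        toPS _ M (alternant M l.parts))) := by
    intro l
    rw [← MvPowerSeries.coeff_C_mul]
    congr 1
    ring
  simp_rw [h1]
  rw [← map_sum, ← Finset.mul_sum, MvPowerSeries.coeff_mul, MvPowerSeries.coeff_mul]
  refine Finset.sum_congr rfl fun p hp => ?_
  congr 1
  rw [Finset.HasAntidiagonal.mem_antidiagonal] at hp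
  rw [coeff_vker, jt_expand (D := D), map_sum, map_sum]
  · refine Finset.sum_congr rfl fun l _ => ?_
    rw [MvPowerSeries.coeff_C_mul, coeff_toPS, map_zsmul, zsmul_eq_mul, mul_comm]
  · intro j
    have := hγ j
    rw [← hp] at this
    simp at this
    omega

lemma coeff_vker_two {A : Type*} [CommRing A] {M D : ℕ} (x y : Fin M → A) (ν : Partn)
    (hD : ν.parts 0 ≤ D) :
    MvPowerSeries.coeff (expo M ν.parts) (toPS _ M (vandermondeP M) * (ker M x * ker M y)) =
      ∑ l ∈ box M D, ∑ m ∈ box M D, aeval x (schur M l.parts) * (aeval y (schur M m.parts) *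
        ((lrM M l m ν : ℤ) : A)) := by
  have hγ : ∀ j, expo M ν.parts j + 1 ≤ D + M := by
    intro j
    have := ν.antitone 0 j (Nat.zero_le _)
    have := j.2
    simp only [expo_apply]
    omega
  have e1 : toPS A M (vandermondeP M) * (ker M x * ker M y) =
      ker M y * (toPS A M (vandermondeP M) * ker M x) := by ring
  rw [e1, coeff_mul_vker x _ hγ]
  refine Finset.sum_congr rfl fun l _ => ?_
  rw [← Finset.mul_sum]
  congr 1
  have e2 : ker M y * toPS A M (alternant M l.parts) =
      toPS A M (schur M l.parts) * (toPS A M (vandermondeP M) * ker M y) := by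
    rw [← schur_mul, map_mul]
    ring
  rw [e2, coeff_mul_vker y _ hγ]
  refine Finset.sum_congr rfl fun m _ => ?_
  rw [← map_mul, coeff_toPS, lrM, ← schur_mul, mul_assoc]

lemma geo_zero {A : Type*} [CommRing A] {M : ℕ} (j : Fin M) : geo (0 : A) j = 1 := by
  have := geo_mul (0 : A) j
  simpa using this

lemma ker_pad {A : Type*} [CommRing A] {n M : ℕ} (h : n ≤ M) (v : Fin n → A) :
    ker M (pad M v) = ker M v := by
  rw [ker, ker]
  obtain ⟨k, rfl⟩ := Nat.exists_eq_add_of_le h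
  rw [Fin.prod_univ_add]
  have : ∀ i : Fin k, ∏ j : Fin (n + k), geo (pad (n + k) v (Fin.natAdd n i)) j = 1 := by
    intro i
    refine Finset.prod_eq_one fun j _ => ?_
    simp [pad, geo_zero]
  simp only [this, Finset.prod_const_one, mul_one]
  refine Finset.prod_congr rfl fun i _ => ?_
  simp [pad]

/-- evaluation at elements of a ring, using the canonical `ℤ`-algebra structure -/
noncomputable def ev {A σ : Type*} [CommRing A] (x : σ → A) : MvPolynomial σ ℤ →ₐ[ℤ] A := aeval x

lemma rename_eq_ev {σ τ : Type*} (g : σ → τ) (f : MvPolynomial σ ℤ) :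
    rename g f = ev (fun i => (X (g i) : MvPolynomial τ ℤ)) f := by
  induction f using MvPolynomial.induction_on with
  | C a => rw [rename_C, ev, eq_intCast C a, eq_intCast C a, map_intCast]
  | add p q hp hq => rw [map_add, map_add, hp, hq]
  | mul_X p i hp => rw [map_mul, map_mul, hp, rename_X, ev, aeval_X]

theorem schur_coproduct (n m : ℕ) (hn : 0 < n) (hm : 0 < m) (ν : Partn)
    (hν : ν.LengthLE (n + m)) :
    rename (finSumFinEquiv.symm : Fin (n + m) → Fin n ⊕ Fin m) (schur (n + m) ν.parts) =
    ∑ᶠ (l : Partn) (μ : Partn)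
        (_ : l.LengthLE n ∧ μ.LengthLE m ∧ l.weight + μ.weight = ν.weight),
      lrCoeff l μ ν •
        (rename Sum.inl (schur n l.parts) * rename Sum.inr (schur m μ.parts)) := by

  set N := ν.weight with hN
  set M := n + m + N with hM
  set x : Fin n → MvPolynomial (Fin n ⊕ Fin m) ℤ := fun i => X (Sum.inl i) with hx
  set y : Fin m → MvPolynomial (Fin n ⊕ Fin m) ℤ := fun i => X (Sum.inr i) with hy
  set w : Fin (n + m) → MvPolynomial (Fin n ⊕ Fin m) ℤ := fun i => X (finSumFinEquiv.symm i) with hw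
  have hνM : ν.LengthLE M := fun i hi => hν i (by omega)
  have hker : ker M (pad M w) = ker M (pad M x) * ker M (pad M y) := by
    rw [ker_pad (by omega), ker_pad (by omega), ker_pad (by omega), ker, ker, ker,
      Fin.prod_univ_add]
    simp [hw, hx, hy]
  have hL : rename (finSumFinEquiv.symm : Fin (n + m) → Fin n ⊕ Fin m) (schur (n + m) ν.parts) =
      ev w (schur (n + m) ν.parts) := by
    exact rename_eq_ev _ _
  have hxl : ∀ f : MvPolynomial (Fin n) ℤ,
      rename (Sum.inl : Fin n → Fin n ⊕ Fin m) f = ev x f := by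
    intro f
    exact rename_eq_ev _ _
  have hyl : ∀ f : MvPolynomial (Fin m) ℤ,
      rename (Sum.inr : Fin m → Fin n ⊕ Fin m) f = ev y f := by
    intro f
    exact rename_eq_ev _ _
  rw [hL, ev, ← aeval_pad_schur w ν (M := M) (by omega) hν, ← jt_expo, ← coeff_vker, hker,
    coeff_vker_two (D := N) _ _ ν ν.parts_zero_le]
  have hbox : ∀ (l : Partn) (k : ℕ), k ≤ n + m → l.LengthLE k → l.weight ≤ N → l ∈ box M N := by
    intro l k hk hl hw
    exact mem_box.2 ⟨fun i hi => hl i (by omega), l.parts_zero_le.trans hw⟩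
  have hinner : ∀ l : Partn, (∑ᶠ (μ : Partn)
        (_ : l.LengthLE n ∧ μ.LengthLE m ∧ l.weight + μ.weight = N),
      lrCoeff l μ ν • (rename Sum.inl (schur n l.parts) * rename Sum.inr (schur m μ.parts) :
        MvPolynomial (Fin n ⊕ Fin m) ℤ)) =
      ∑ μ ∈ box M N, if l.LengthLE n ∧ μ.LengthLE m ∧ l.weight + μ.weight = N then
        lrCoeff l μ ν • (ev x (schur n l.parts) * ev y (schur m μ.parts)) else 0 := by
    intro l
    simp_rw [finsum_eq_if, hxl, hyl]
    apply finsum_eq_sum_of_support_subset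
    intro μ hμ
    rw [Function.mem_support] at hμ
    have hc : l.LengthLE n ∧ μ.LengthLE m ∧ l.weight + μ.weight = N := by
      by_contra h
      rw [if_neg h] at hμ
      exact hμ rfl
    exact hbox μ m (by omega) hc.2.1 (by omega)
  simp_rw [hinner]
  rw [finsum_eq_sum_of_support_subset (s := box M N)]
  · refine Finset.sum_congr rfl fun l hl => Finset.sum_congr rfl fun μ hμ => ?_
    rw [mem_box] at hl hμ
    by_cases h1 : l.LengthLE n
    · by_cases h2 : μ.LengthLE m
      · rw [ev, ev, aeval_pad_schur x l (by omega) h1, aeval_pad_schur y μ (by omega) h2]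
        by_cases h3 : l.weight + μ.weight = N
        · rw [if_pos ⟨h1, h2, h3⟩, lrCoeff_eq l μ ν (M := M) h3 (by omega), zsmul_eq_mul]
          ring
        · rw [if_neg (by tauto), lrM_zero M l μ ν hl.1 hμ.1 hνM h3]
          simp
      · rw [if_neg (by tauto), aeval_pad_schur_zero y μ (by omega) hμ.1 h2]
        simp
    · rw [if_neg (by tauto), aeval_pad_schur_zero x l (by omega) hl.1 h1]
      simp
  · intro l hl
    rw [Function.mem_support] at hl
    obtain ⟨μ, _, hμ⟩ := Finset.exists_ne_zero_of_sum_ne_zero hl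
    have hc : l.LengthLE n ∧ μ.LengthLE m ∧ l.weight + μ.weight = N := by
      by_contra h
      rw [if_neg h] at hμ
      exact hμ rfl
    exact hbox l n (by omega) hc.1 (by omega)
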